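/- Let Q : ℕ × ℕ → ℕ satisfy Q(1,d) = 1 for all d, Q(n,0) = 1 for all n, and Q(n,d) = Q(n−1,d) + (n−1)·Q(n−1,d−1) for n ≥ 2, d ≥ 1. Then for Lebesgue-almost every configuration of points (θ_1,…,θ_n) ∈ (ℝ^d)^n, the number of realizable rankings equals Q(n,d), i.e. |Σ_{n,d}| = Q(n,d). -/

import Mathlib

open MeasureTheory

/-- A ranking (linear order of `{1,…,n}`, encoded as a permutation `σ` sending rank
positions to objects, so that `i` precedes `j` iff `σ⁻¹ i < σ⁻¹ j`) is realizable for the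
configuration `θ` if some reference point `r` orders the objects by distance accordingly. -/
def realizableRankings {n d : ℕ} (θ : Fin n → EuclideanSpace ℝ (Fin d)) :
    Set (Equiv.Perm (Fin n)) :=
  {σ | ∃ r : EuclideanSpace ℝ (Fin d),
    ∀ i j : Fin n, σ.symm i < σ.symm j ↔ dist (θ i) r < dist (θ j) r}

open Classical in
/-- The strict comparisons `f i r < f j r` between the first `m` functions at the point `r`. -/
noncomputable def orderPattern {X : Type*} {n : ℕ} (f : Fin n → X → ℝ) (m : ℕ) (r : X) :
    Finset (Fin n × Fin n) :=
  Finset.univ.filter fun a => (a.1 : ℕ) < m ∧ (a.2 : ℕ) < m ∧ f a.1 r < f a.2 r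

/-- The values of the first `m` functions at `r` are pairwise distinct. -/
def DistinctValues {X : Type*} {n : ℕ} (f : Fin n → X → ℝ) (m : ℕ) (r : X) : Prop :=
  ∀ a b : Fin n, (a : ℕ) < m → (b : ℕ) < m → f a r = f b r → a = b

open Classical in
/-- The order patterns of the first `m` functions realized at points of `F` without ties. -/
noncomputable def orderPatterns {X : Type*} {n : ℕ} (f : Fin n → X → ℝ) (m : ℕ) (F : Set X) :
    Finset (Finset (Fin n × Fin n)) :=
  Finset.univ.filter fun T => ∃ r ∈ F, DistinctValues f m r ∧ orderPattern f m r = T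

section Patterns

variable {X : Type*} {n : ℕ} {f : Fin n → X → ℝ} {m : ℕ} {F : Set X}

theorem mem_orderPatterns {T : Finset (Fin n × Fin n)} :
    T ∈ orderPatterns f m F ↔ ∃ r ∈ F, DistinctValues f m r ∧ orderPattern f m r = T := by
  simp [orderPatterns]

theorem orderPattern_eq_iff {r s : X} : orderPattern f m r = orderPattern f m s ↔
    ∀ a b : Fin n, (a : ℕ) < m → (b : ℕ) < m → (f a r < f b r ↔ f a s < f b s) := by
  simp only [orderPattern, Finset.ext_iff, Finset.mem_filter, Finset.mem_univ, true_and,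
    Prod.forall]
  grind

theorem orderPattern_succ_eq_iff {r s : X} (hm : m < n) (hr : DistinctValues f (m + 1) r)
    (hs : DistinctValues f (m + 1) s) :
    orderPattern f (m + 1) r = orderPattern f (m + 1) s ↔
    orderPattern f m r = orderPattern f m s ∧
      ∀ a : Fin n, (a : ℕ) < m → (f a r < f ⟨m, hm⟩ r ↔ f a s < f ⟨m, hm⟩ s) := by
  rw [orderPattern_eq_iff, orderPattern_eq_iff]
  constructor
  · intro h
    exact ⟨fun a b ha hb => h a b (by omega) (by omega),
      fun a ha => h a ⟨m, hm⟩ (by omega) (by simp)⟩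
  · rintro ⟨h1, h2⟩ a b ha hb
    rcases Nat.lt_succ_iff_lt_or_eq.1 ha with ha' | ha' <;>
    rcases Nat.lt_succ_iff_lt_or_eq.1 hb with hb' | hb'
    · exact h1 a b ha' hb'
    · obtain rfl : b = ⟨m, hm⟩ := Fin.ext hb'
      exact h2 a ha'
    · obtain rfl : a = ⟨m, hm⟩ := Fin.ext ha'
      have hne : b ≠ ⟨m, hm⟩ := fun h => by simp [h] at hb'
      have e1 : f b r ≠ f ⟨m, hm⟩ r := fun h => hne (hr _ _ hb ha h)
      have e2 : f b s ≠ f ⟨m, hm⟩ s := fun h => hne (hs _ _ hb ha h)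
      have := h2 b hb'
      constructor <;> intro h
      · exact lt_of_le_of_ne (not_lt.1 fun h' => (h.trans (this.2 h')).false) e2.symm
      · exact lt_of_le_of_ne (not_lt.1 fun h' => (h.trans (this.1 h')).false) e1.symm
    · obtain rfl : a = ⟨m, hm⟩ := Fin.ext ha'
      obtain rfl : b = ⟨m, hm⟩ := Fin.ext hb'
      exact iff_of_false (lt_irrefl _) (lt_irrefl _)

/-- Near a point where the `q`-th function ties with another one, the tie can be broken
either way, and on the way between two orders of that pair a tie occurs. -/
structure CrossesTies (f : Fin n → X → ℝ) (q : Fin n) (F : Set X) : Prop where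
  raise : ∀ r ∈ F, ∀ i < q, f i r = f q r →
    ∃ s ∈ F, (∀ a b, f a r < f b r → f a s < f b s) ∧ f i s < f q s
  lower : ∀ r ∈ F, ∀ i < q, f i r = f q r →
    ∃ s ∈ F, (∀ a b, f a r < f b r → f a s < f b s) ∧ f q s < f i s
  tie : ∀ r ∈ F, ∀ s ∈ F, ∀ i < q, f q r < f i r → f i s < f q s →
    ∃ t ∈ F, f i t = f q t ∧ ∀ a b, f a r < f b r → f a s < f b s → f a t < f b t

theorem DistinctValues.of_lt {r s : X} (hr : DistinctValues f m r)
    (h : ∀ a b, f a r < f b r → f a s < f b s) :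
    DistinctValues f m s ∧ orderPattern f m s = orderPattern f m r := by
  have key : ∀ a b : Fin n, (a : ℕ) < m → (b : ℕ) < m → a ≠ b → (f a r < f b r ∧ f a s < f b s) ∨
      (f b r < f a r ∧ f b s < f a s) := by
    intro a b ha hb hab
    rcases lt_trichotomy (f a r) (f b r) with h1 | h1 | h1
    · exact .inl ⟨h1, h _ _ h1⟩
    · exact absurd (hr a b ha hb h1) hab
    · exact .inr ⟨h1, h _ _ h1⟩
  refine ⟨fun a b ha hb hab => ?_, orderPattern_eq_iff.2 fun a b ha hb => ?_⟩
  · by_contra hne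
    rcases key a b ha hb hne with h1 | h1 <;> linarith
  · by_cases hab : a = b
    · simp [hab]
    · rcases key a b ha hb hab with h1 | h1
      · simp [h1]
      · exact iff_of_false h1.2.not_gt h1.1.not_gt

theorem DistinctValues.succ (hm : m < n) {s : X} (hs : DistinctValues f m s)
    (h : ∀ a : Fin n, (a : ℕ) < m → f a s ≠ f ⟨m, hm⟩ s) : DistinctValues f (m + 1) s := by
  intro a b ha hb hab
  rcases Nat.lt_succ_iff_lt_or_eq.1 ha with ha' | ha' <;>
  rcases Nat.lt_succ_iff_lt_or_eq.1 hb with hb' | hb'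
  · exact hs a b ha' hb' hab
  · obtain rfl : b = ⟨m, hm⟩ := Fin.ext hb'
    exact absurd hab (h a ha')
  · obtain rfl : a = ⟨m, hm⟩ := Fin.ext ha'
    exact absurd hab.symm (h b hb')
  · exact Fin.ext (by omega)

theorem DistinctValues.mono {k : ℕ} (hk : k ≤ m) {s : X} (hs : DistinctValues f m s) :
    DistinctValues f k s :=
  fun a b ha hb => hs a b (by omega) (by omega)

open Classical in
/-- The patterns extending `T` to one more function are one more than the ties of the new
function compatible with `T`. -/
theorem card_extensions (hm : m < n) (hF : CrossesTies f ⟨m, hm⟩ F)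
    {T : Finset (Fin n × Fin n)} (hT : T ∈ orderPatterns f m F) :
    ((orderPatterns f (m + 1) F).filter
      fun Y => Y.filter (fun a => (a.1 : ℕ) < m ∧ (a.2 : ℕ) < m) = T).card =
    (Finset.univ.filter fun i : Fin n => (i : ℕ) < m ∧
      T ∈ orderPatterns f m (F ∩ {r | f i r = f ⟨m, hm⟩ r})).card + 1 := by
  set q : Fin n := ⟨m, hm⟩ with hq
  set A := (orderPatterns f (m + 1) F).filter
      fun Y => Y.filter (fun a => (a.1 : ℕ) < m ∧ (a.2 : ℕ) < m) = T with hA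
  have restrict : ∀ r, (orderPattern f (m + 1) r).filter
      (fun a => (a.1 : ℕ) < m ∧ (a.2 : ℕ) < m) = orderPattern f m r := by
    intro r
    ext a
    simp only [orderPattern, Finset.mem_filter, Finset.mem_univ, true_and]
    grind
  have memA : ∀ Y, Y ∈ A ↔ ∃ r ∈ F, DistinctValues f (m + 1) r ∧ orderPattern f m r = T ∧
      orderPattern f (m + 1) r = Y := by
    intro Y
    simp only [hA, Finset.mem_filter, mem_orderPatterns]
    constructor
    · rintro ⟨⟨r, h1, h2, rfl⟩, h3⟩
      exact ⟨r, h1, h2, (restrict r).symm.trans h3, rfl⟩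
    · rintro ⟨r, h1, h2, h3, rfl⟩
      exact ⟨⟨r, h1, h2, rfl⟩, (restrict r).trans h3⟩
  let below : X → Finset (Fin n) := fun r => Finset.univ.filter fun a => (a : ℕ) < m ∧ f a r < f q r
  have mem_below : ∀ r a, a ∈ below r ↔ (a : ℕ) < m ∧ f a r < f q r := by simp [below]
  -- breaking a tie stays within the region of `T`
  have broken : ∀ (r s : X) (i : Fin n), (i : ℕ) < m → DistinctValues f m r → orderPattern f m r = T →
      f i r = f q r → (∀ a b, f a r < f b r → f a s < f b s) → f i s ≠ f q s →
      DistinctValues f (m + 1) s ∧ orderPattern f m s = T ∧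
        ∀ a : Fin n, (a : ℕ) < m → a ≠ i → (f a s < f q s ↔ f a r < f i r) := by
    intro r s i hi hr hrT hti h hne
    obtain ⟨h1, h2⟩ := hr.of_lt h
    have h3 : ∀ a : Fin n, (a : ℕ) < m → a ≠ i → (f a r < f i r ∧ f a s < f q s) ∨
        (f i r < f a r ∧ f q s < f a s) := by
      intro a ha hai
      rcases lt_trichotomy (f a r) (f i r) with h4 | h4 | h4
      · exact .inl ⟨h4, h _ _ (hti ▸ h4)⟩
      · exact absurd (hr a i ha hi h4) hai
      · exact .inr ⟨h4, h _ _ (hti ▸ h4)⟩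
    refine ⟨h1.succ hm fun a ha => ?_, h2.trans hrT, fun a ha hai => ?_⟩
    · by_cases hai : a = i
      · exact hai ▸ hne
      · rcases h3 a ha hai with h4 | h4
        · exact h4.2.ne
        · exact h4.2.ne'
    · rcases h3 a ha hai with h4 | h4
      · simp [h4]
      · exact iff_of_false h4.2.not_gt h4.1.not_gt
  have Ane : A.Nonempty := by
    obtain ⟨r, hrF, hr, hrT⟩ := mem_orderPatterns.1 hT
    by_cases h : ∀ a : Fin n, (a : ℕ) < m → f a r ≠ f q r
    · exact ⟨_, (memA _).2 ⟨r, hrF, hr.succ hm h, hrT, rfl⟩⟩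
    · push Not at h
      obtain ⟨i, hi, hti⟩ := h
      obtain ⟨s, hsF, hs, hlt⟩ := hF.raise r hrF i hi hti
      obtain ⟨h1, h2, -⟩ := broken r s i hi hr hrT hti hs hlt.ne
      exact ⟨_, (memA _).2 ⟨s, hsF, h1, h2, rfl⟩⟩
  -- a point of the extended region where `q` is above the most functions
  obtain ⟨r₀, ⟨hr₀F, hr₀, hr₀T⟩, hmax⟩ : ∃ r₀, (r₀ ∈ F ∧ DistinctValues f (m + 1) r₀ ∧
      orderPattern f m r₀ = T) ∧ ∀ r, r ∈ F → DistinctValues f (m + 1) r →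
      orderPattern f m r = T → (below r).card ≤ (below r₀).card := by
    let N : Finset ℕ := (Finset.range (n + 1)).filter fun k => ∃ r ∈ F,
      DistinctValues f (m + 1) r ∧ orderPattern f m r = T ∧ (below r).card = k
    have hN : ∀ r, r ∈ F → DistinctValues f (m + 1) r → orderPattern f m r = T →
        (below r).card ∈ N := fun r h1 h2 h3 => by
      refine Finset.mem_filter.2 ⟨Finset.mem_range.2 ?_, r, h1, h2, h3, rfl⟩
      have := Finset.card_le_univ (below r)
      simp at this
      omega
    obtain ⟨Y, hY⟩ := Ane
    obtain ⟨r, h1, h2, h3, -⟩ := (memA _).1 hY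
    obtain ⟨k, hk, hk'⟩ := N.exists_max_image id ⟨_, hN r h1 h2 h3⟩
    obtain ⟨-, r₀, g1, g2, g3, rfl⟩ := Finset.mem_filter.1 hk
    exact ⟨r₀, ⟨g1, g2, g3⟩, fun r h1 h2 h3 => hk' _ (hN r h1 h2 h3)⟩
  have hY₀ : orderPattern f (m + 1) r₀ ∈ A := (memA _).2 ⟨r₀, hr₀F, hr₀, hr₀T, rfl⟩
  rw [← Finset.card_erase_add_one hY₀]
  congr 1
  symm
  have hlow : ∀ i : Fin n, i ∈ (Finset.univ.filter fun i : Fin n => (i : ℕ) < m ∧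
      T ∈ orderPatterns f m (F ∩ {r | f i r = f q r})) →
      (i : ℕ) < m ∧ ∃ s ∈ F, DistinctValues f (m + 1) s ∧ orderPattern f m s = T ∧
      f q s < f i s ∧ (∀ a : Fin n, (a : ℕ) < m → (f a s < f q s ↔ f a s < f i s)) ∧
      orderPattern f (m + 1) s ≠ orderPattern f (m + 1) r₀ := by
    intro i hi
    obtain ⟨-, him, hi⟩ := Finset.mem_filter.1 hi
    obtain ⟨r, ⟨hrF, hti⟩, hr, hrT⟩ := mem_orderPatterns.1 hi
    obtain ⟨s, hsF, hs, hlt⟩ := hF.lower r hrF i him hti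
    obtain ⟨t, htF, ht, hgt⟩ := hF.raise r hrF i him hti
    obtain ⟨s1, s2, s3⟩ := broken r s i him hr hrT hti hs hlt.ne'
    obtain ⟨t1, t2, t3⟩ := broken r t i him hr hrT hti ht hgt.ne
    refine ⟨him, s, hsF, s1, s2, hlt, fun a ha => ?_, fun heq => ?_⟩
    · by_cases hai : a = i
      · subst hai; simp [hlt.le]
      · rw [s3 a ha hai]
        exact (orderPattern_eq_iff.1 (hrT.trans s2.symm)) a i ha him
    · have e := ((orderPattern_succ_eq_iff hm s1 hr₀).1 heq).2
      have hb : below r₀ = below s := by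
        ext a
        simp only [mem_below]
        exact and_congr_right fun ha => (e a ha).symm
      have hss : below s ⊂ below t := by
        refine (Finset.ssubset_iff_of_subset fun a => ?_).2 ⟨i, ?_, ?_⟩
        · simp only [mem_below]
          rintro ⟨ha, h⟩
          refine ⟨ha, ?_⟩
          by_cases hai : a = i
          · exact hai ▸ hgt
          · exact (t3 a ha hai).2 ((s3 a ha hai).1 h)
        · exact (mem_below _ _).2 ⟨him, hgt⟩
        · simp [mem_below, hlt.le]
      have := Finset.card_lt_card hss
      have := hmax t htF t1 t2
      rw [hb] at this
      omega
  have : Nonempty X := ⟨r₀⟩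
  choose! him s hsF hs1 hsT hlt hiff hne using hlow
  refine Finset.card_bij (fun i _ => orderPattern f (m + 1) (s i)) ?_ ?_ ?_
  · intro i hi
    exact Finset.mem_erase.2 ⟨hne i hi, (memA _).2 ⟨s i, hsF i hi, hs1 i hi, hsT i hi, rfl⟩⟩
  · intro i hi j hj hij
    have e := ((orderPattern_succ_eq_iff hm (hs1 i hi) (hs1 j hj)).1 hij).2
    have e' := orderPattern_eq_iff.1 ((hsT i hi).trans (hsT j hj).symm)
    have h1 := e i (him i hi)
    have h2 := e j (him j hj)
    have h3 := hiff i hi j (him j hj)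
    have h4 := hiff j hj i (him i hi)
    have h5 := e' i j (him i hi) (him j hj)
    have h6 := hlt i hi
    have h7 := hlt j hj
    refine hs1 i hi i j ((him i hi).trans (by simp)) ((him j hj).trans (by simp)) ?_
    apply le_antisymm
    · exact not_lt.1 fun h => h7.not_gt (h2.1 (h3.2 h))
    · exact not_lt.1 fun h => h6.not_gt (h1.2 (h4.2 (h5.1 h)))
  · intro Y hY
    obtain ⟨hYne, hY⟩ := Finset.mem_erase.1 hY
    obtain ⟨r, hrF, hr, hrT, rfl⟩ := (memA _).1 hY
    have e := orderPattern_eq_iff.1 (hrT.trans hr₀T.symm)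
    have hnot : ¬ below r₀ ⊆ below r := by
      intro hsub
      have heq := Finset.eq_of_subset_of_card_le hsub (hmax r hrF hr hrT)
      refine hYne ((orderPattern_succ_eq_iff hm hr hr₀).2 ⟨hrT.trans hr₀T.symm, fun a ha => ?_⟩)
      have := Finset.ext_iff.1 heq a
      simp only [mem_below, ha, true_and] at this
      exact this.symm
    obtain ⟨i, hi, hi'⟩ := (below r₀ \ below r).exists_min_image (fun i => f i r)
      (Finset.sdiff_nonempty.2 hnot)
    simp only [Finset.mem_sdiff, mem_below, not_and, not_lt] at hi hi'
    obtain ⟨⟨him', hi0⟩, hir⟩ := hi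
    have hir : f q r < f i r := lt_of_le_of_ne (hir him') fun h =>
      absurd (hr q i (by simp [hq]) (by omega) h) (by rintro rfl; simp [hq] at him')
    have hiK : i ∈ (Finset.univ.filter fun i : Fin n => (i : ℕ) < m ∧
        T ∈ orderPatterns f m (F ∩ {r | f i r = f q r})) := by
      refine Finset.mem_filter.2 ⟨Finset.mem_univ _, him', mem_orderPatterns.2 ?_⟩
      obtain ⟨t, htF, hti, ht⟩ := hF.tie r hrF r₀ hr₀F i him' hir hi0
      have hrm : DistinctValues f m r := hr.mono (by omega)
      have key : ∀ a b : Fin n, (a : ℕ) < m → (b : ℕ) < m → f a r < f b r → f a t < f b t :=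
        fun a b ha hb h => ht a b h ((e a b ha hb).1 h)
      have key' : ∀ a b : Fin n, (a : ℕ) < m → (b : ℕ) < m → a ≠ b →
          f a r < f b r ∨ f b r < f a r := fun a b ha hb hab =>
        lt_or_gt_of_ne fun h => hab (hrm a b ha hb h)
      refine ⟨t, ⟨htF, hti⟩, fun a b ha hb hab => ?_, ?_⟩
      · by_contra hne
        rcases key' a b ha hb hne with h | h
        · exact (key a b ha hb h).ne hab
        · exact (key b a hb ha h).ne' hab
      · refine (orderPattern_eq_iff.2 fun a b ha hb => ⟨fun h => ?_, key a b ha hb⟩).trans hrT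
        by_cases hab : a = b
        · subst hab; exact absurd h (lt_irrefl _)
        · rcases key' a b ha hb hab with h' | h'
          · exact h'
          · exact absurd h (key b a hb ha h').not_gt
    refine ⟨i, hiK, (orderPattern_succ_eq_iff hm (hs1 i hiK) hr).2
      ⟨(hsT i hiK).trans hrT.symm, fun a ha => ?_⟩⟩
    rw [hiff i hiK a ha, orderPattern_eq_iff.1 ((hsT i hiK).trans hrT.symm) a i ha him']
    constructor
    · intro h
      by_contra h'
      have h0 : f a r₀ < f q r₀ := ((e a i ha him').1 h).trans hi0
      exact absurd (hi' a ⟨⟨ha, h0⟩, fun _ => not_lt.1 h'⟩) (not_le.2 h)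
    · exact fun h => h.trans hir

open Classical in
theorem card_orderPatterns_succ (hm : m < n) (hF : CrossesTies f ⟨m, hm⟩ F) :
    (orderPatterns f (m + 1) F).card = (orderPatterns f m F).card +
      ∑ i ∈ Finset.univ.filter (fun i : Fin n => (i : ℕ) < m),
        (orderPatterns f m (F ∩ {r | f i r = f ⟨m, hm⟩ r})).card := by
  have hmaps : ∀ Y ∈ orderPatterns f (m + 1) F,
      Y.filter (fun a => (a.1 : ℕ) < m ∧ (a.2 : ℕ) < m) ∈ orderPatterns f m F := by
    intro Y hY
    obtain ⟨r, hrF, hr, rfl⟩ := mem_orderPatterns.1 hY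
    refine mem_orderPatterns.2 ⟨r, hrF, hr.mono (by omega), ?_⟩
    ext a
    simp only [orderPattern, Finset.mem_filter, Finset.mem_univ, true_and]
    grind
  rw [Finset.card_eq_sum_card_fiberwise hmaps,
    Finset.sum_congr rfl fun T hT => card_extensions hm hF hT, Finset.sum_add_distrib, add_comm]
  congr 1
  · simp
  · have := Finset.sum_card_bipartiteAbove_eq_sum_card_bipartiteBelow
      (s := orderPatterns f m F) (t := Finset.univ.filter fun i : Fin n => (i : ℕ) < m)
      (fun T i => T ∈ orderPatterns f m (F ∩ {r | f i r = f ⟨m, hm⟩ r}))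
    refine Eq.trans (Finset.sum_congr rfl fun T _ => ?_)
      (this.trans (Finset.sum_congr rfl fun i _ => ?_))
    · rw [Finset.bipartiteAbove, Finset.filter_filter]
    · congr 1
      ext T
      simp only [Finset.bipartiteBelow, Finset.mem_filter, mem_orderPatterns]
      grind

end Patterns

section Geometry

variable {n : ℕ} {E : Type*} [NormedAddCommGroup E] [InnerProductSpace ℝ E]

/-- The squared distance from `θ i` to `r`, up to the summand `‖r‖ ^ 2` shared by all `i`. -/
noncomputable def power (θ : Fin n → E) (i : Fin n) (r : E) : ℝ :=
  ‖θ i‖ ^ 2 - 2 * inner ℝ (θ i) r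

theorem power_eq (θ : Fin n → E) (i : Fin n) (r : E) :
    power θ i r = dist (θ i) r ^ 2 - ‖r‖ ^ 2 := by
  rw [power, dist_eq_norm, norm_sub_sq_real]
  ring

theorem power_lt_iff (θ : Fin n → E) (i j : Fin n) (r : E) :
    power θ i r < power θ j r ↔ dist (θ i) r < dist (θ j) r := by
  rw [power_eq, power_eq, sub_lt_sub_iff_right]
  exact pow_lt_pow_iff_left₀ dist_nonneg dist_nonneg two_ne_zero

theorem power_eq_iff_inner (θ : Fin n → E) (i j : Fin n) (r : E) :
    power θ i r = power θ j r ↔ inner ℝ (θ i - θ j) r = (‖θ i‖ ^ 2 - ‖θ j‖ ^ 2) / 2 := by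
  rw [power, power, inner_sub_left]
  constructor <;> intro h <;> linarith

theorem power_add_smul (θ : Fin n → E) (i : Fin n) (r w : E) (t : ℝ) :
    power θ i (r + t • w) = power θ i r - 2 * t * inner ℝ (θ i) w := by
  rw [power, power, inner_add_right, inner_smul_right]
  ring

/-- The points at equal distance from `θ v` and `θ (p v)` for all `v ∈ S`. -/
def bisectorFlat (θ : Fin n → E) (S : Finset (Fin n)) (p : Fin n → Fin n) : Set E :=
  {r | ∀ v ∈ S, power θ v r = power θ (p v) r}

/-- Bisectors along forests (every vertex `v ∈ S` has a smaller parent `p v`) meet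
transversally. -/
structure GenericConfiguration (d : ℕ) (θ : Fin n → E) : Prop where
  linearIndepOn : ∀ (S : Finset (Fin n)) (p : Fin n → Fin n), (∀ v ∈ S, p v < v) → S.card ≤ d →
    LinearIndepOn ℝ (fun v => θ v - θ (p v)) (S : Set (Fin n))
  flat_eq_empty : ∀ (S : Finset (Fin n)) (p : Fin n → Fin n), (∀ v ∈ S, p v < v) →
    S.card = d + 1 → bisectorFlat θ S p = ∅

theorem eventually_power_lt (θ : Fin n → E) (r w : E) :
    ∀ᶠ t : ℝ in nhds 0, ∀ a b, power θ a r < power θ b r →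
      power θ a (r + t • w) < power θ b (r + t • w) := by
  refine Filter.eventually_all.2 fun a => Filter.eventually_all.2 fun b => ?_
  by_cases h : power θ a r < power θ b r
  · simp only [h, true_imp_iff, power_add_smul]
    refine ContinuousAt.eventually_lt (by fun_prop) (by fun_prop) ?_
    simpa using h
  · exact Filter.Eventually.of_forall fun t h' => absurd h' h

theorem crossesTies_bisectorFlat (θ : Fin n → E) (S : Finset (Fin n)) (p : Fin n → Fin n)
    (q : Fin n) (hw : ∀ i < q, ∃ w : E, (∀ v ∈ S, inner ℝ (θ v - θ (p v)) w = 0) ∧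
      inner ℝ (θ q - θ i) w = 1) :
    CrossesTies (power θ) q (bisectorFlat θ S p) := by
  have perturb : ∀ r ∈ bisectorFlat θ S p, ∀ i < q, power θ i r = power θ q r → ∀ c : ℝ,
      c ≠ 0 → ∃ t : ℝ, 0 < t ∧ ∃ s ∈ bisectorFlat θ S p,
      (∀ a b, power θ a r < power θ b r → power θ a s < power θ b s) ∧
      power θ q s - power θ i s = t * c := by
    intro r hr i hi hti c hc
    obtain ⟨w, hw1, hw2⟩ := hw i hi
    have h1 := (eventually_power_lt θ r ((-c / 2) • w)).filter_mono
      (nhdsWithin_le_nhds (s := Set.Ioi 0))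
    obtain ⟨t, ht, ht0⟩ := (h1.and self_mem_nhdsWithin).exists
    refine ⟨t, ht0, r + t • ((-c / 2) • w), fun v hv => ?_, ht, ?_⟩
    · have := hw1 v hv
      rw [inner_sub_left] at this
      rw [power_add_smul, power_add_smul, hr v hv, inner_smul_right, inner_smul_right,
        sub_eq_zero.1 this]
    · rw [inner_sub_left] at hw2
      rw [power_add_smul, power_add_smul, inner_smul_right, inner_smul_right, hti]
      linear_combination t * c * hw2
  refine ⟨fun r hr i hi hti => ?_, fun r hr i hi hti => ?_, fun r hr s hs i hi h1 h2 => ?_⟩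
  · obtain ⟨t, ht, s, hs, h1, h2⟩ := perturb r hr i hi hti 1 one_ne_zero
    exact ⟨s, hs, h1, by linarith⟩
  · obtain ⟨t, ht, s, hs, h1, h2⟩ := perturb r hr i hi hti (-1) (by norm_num)
    exact ⟨s, hs, h1, by linarith⟩
  · set t : ℝ := (power θ i r - power θ q r) /
      ((power θ i r - power θ q r) + (power θ q s - power θ i s)) with ht
    have hden : 0 < (power θ i r - power θ q r) + (power θ q s - power θ i s) := by linarith
    have ht0 : 0 < t := div_pos (by linarith) hden
    have ht1 : t < 1 := (div_lt_one hden).2 (by linarith)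
    have htmul : t * ((power θ i r - power θ q r) + (power θ q s - power θ i s)) =
        power θ i r - power θ q r := div_mul_cancel₀ _ hden.ne'
    have hseg : ∀ a, power θ a (r + t • (s - r)) = (1 - t) * power θ a r + t * power θ a s := by
      intro a
      rw [power_add_smul, power, power, inner_sub_right]
      ring
    refine ⟨r + t • (s - r), fun v hv => ?_, ?_, fun a b ha hb => ?_⟩
    · rw [hseg, hseg, hr v hv, hs v hv]
    · rw [hseg, hseg]
      linarith
    · rw [hseg, hseg]
      have := mul_lt_mul_of_pos_left ha (sub_pos.2 ht1)
      have := mul_lt_mul_of_pos_left hb ht0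
      linarith

theorem bisectorFlat_insert (θ : Fin n → E) {S : Finset (Fin n)} {q : Fin n} (hq : q ∉ S)
    (p : Fin n → Fin n) (i : Fin n) :
    bisectorFlat θ (insert q S) (Function.update p q i) =
      bisectorFlat θ S p ∩ {r | power θ i r = power θ q r} := by
  have hS : ∀ v ∈ S, Function.update p q i v = p v := fun v hv =>
    Function.update_of_ne (by rintro rfl; exact hq hv) _ _
  ext r
  simp only [bisectorFlat, Finset.mem_insert, forall_eq_or_imp, Function.update_self,
    Set.mem_inter_iff, Set.mem_ofPred_eq]
  rw [and_comm, eq_comm]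
  exact and_congr_left fun _ => forall₂_congr fun v hv => by rw [hS v hv]

variable [FiniteDimensional ℝ E]

theorem LinearIndepOn.exists_inner_eq {ι : Type*} {u : ι → E} {S : Set ι}
    (hu : LinearIndepOn ℝ u S) (b : ι → ℝ) : ∃ r : E, ∀ v ∈ S, inner ℝ (u v) r = b v := by
  obtain ⟨g, hg⟩ := LinearMap.exists_extend
    ((Module.Basis.span (LinearIndepOn.linearIndependent hu)).constr ℝ fun v => b v)
  refine ⟨(InnerProductSpace.toDual ℝ E).symm (LinearMap.toContinuousLinearMap g),
    fun v hv => ?_⟩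
  rw [real_inner_comm, InnerProductSpace.toDual_symm_apply]
  have h := (Module.Basis.span (LinearIndepOn.linearIndependent hu)).constr_basis ℝ
    (fun v => b v) ⟨v, hv⟩
  rw [← hg] at h
  rw [← h, LinearMap.comp_apply, Submodule.subtype_apply, Module.Basis.span_apply]
  rfl

theorem GenericConfiguration.flat_nonempty {d : ℕ} {θ : Fin n → E}
    (hθ : GenericConfiguration d θ) {S : Finset (Fin n)} {p : Fin n → Fin n}
    (hp : ∀ v ∈ S, p v < v) (hS : S.card ≤ d) : (bisectorFlat θ S p).Nonempty := by
  obtain ⟨r, hr⟩ := (hθ.linearIndepOn S p hp hS).exists_inner_eq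
    fun v => (‖θ v‖ ^ 2 - ‖θ (p v)‖ ^ 2) / 2
  exact ⟨r, fun v hv => (power_eq_iff_inner ..).2 (hr v hv)⟩

theorem GenericConfiguration.flat_subsingleton {θ : Fin n → E}
    (hθ : GenericConfiguration (Module.finrank ℝ E) θ) {S : Finset (Fin n)} {p : Fin n → Fin n}
    (hp : ∀ v ∈ S, p v < v) (hS : S.card = Module.finrank ℝ E) :
    (bisectorFlat θ S p).Subsingleton := by
  intro r hr s hs
  have hli : LinearIndependent ℝ (fun v : S => θ v - θ (p v)) :=
    (hθ.linearIndepOn S p hp hS.le).linearIndependent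
  have hspan := hli.span_eq_top_of_card_eq_finrank' (by simpa using hS)
  have h0 : r - s ∈ (Submodule.span ℝ (Set.range fun v : S => θ v - θ (p v)))ᗮ := by
    rw [Submodule.mem_orthogonal]
    intro u hu
    induction hu using Submodule.span_induction with
    | mem x hx =>
      obtain ⟨v, rfl⟩ := hx
      rw [inner_sub_right, (power_eq_iff_inner ..).1 (hr v v.2),
        (power_eq_iff_inner ..).1 (hs v v.2), sub_self]
    | zero => simp
    | add x y _ _ hx hy => rw [inner_add_left, hx, hy, add_zero]
    | smul a x _ hx => rw [inner_smul_left, hx, mul_zero]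
  rw [hspan, Submodule.top_orthogonal_eq_bot, Submodule.mem_bot] at h0
  exact sub_eq_zero.1 h0

theorem card_orderPatterns_bisectorFlat {θ : Fin n → E}
    (hθ : GenericConfiguration (Module.finrank ℝ E) θ) (Q : ℕ × ℕ → ℕ)
    (hQ1 : ∀ d : ℕ, Q (1, d) = 1)
    (hQ0 : ∀ n : ℕ, Q (n, 0) = 1)
    (hQrec : ∀ n d : ℕ, 2 ≤ n → 1 ≤ d → Q (n, d) = Q (n - 1, d) + (n - 1) * Q (n - 1, d - 1))
    {m : ℕ} (hm1 : 1 ≤ m) (hmn : m ≤ n) (S : Finset (Fin n)) (p : Fin n → Fin n)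
    (hp : ∀ v ∈ S, p v < v) (hSm : ∀ v ∈ S, m ≤ (v : ℕ)) (hS : S.card ≤ Module.finrank ℝ E) :
    (orderPatterns (power θ) m (bisectorFlat θ S p)).card =
      Q (m, Module.finrank ℝ E - S.card) := by
  classical
  have forest : ∀ (S : Finset (Fin n)) (p : Fin n → Fin n) (q i : Fin n), (∀ v ∈ S, p v < v) →
      q ∉ S → i < q → ∀ v ∈ insert q S, Function.update p q i v < v := by
    intro S p q i hp hq hi v hv
    by_cases hvq : v = q
    · subst hvq; simpa using hi
    · rw [Function.update_of_ne hvq]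
      exact hp v ((Finset.mem_insert.1 hv).resolve_left hvq)
  induction m, hm1 using Nat.le_induction generalizing S p with
  | base =>
    obtain ⟨r, hr⟩ := hθ.flat_nonempty hp hS
    rw [hQ1, Finset.card_eq_one]
    refine ⟨orderPattern (power θ) 1 r, Finset.eq_singleton_iff_unique_mem.2
      ⟨mem_orderPatterns.2 ⟨r, hr, fun a b ha hb _ => Fin.ext (by omega), rfl⟩, ?_⟩⟩
    intro T hT
    obtain ⟨s, -, -, rfl⟩ := mem_orderPatterns.1 hT
    refine orderPattern_eq_iff.2 fun a b ha hb => ?_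
    obtain rfl : a = b := Fin.ext (by omega)
    simp
  | succ m hm1 ih =>
    rcases hS.eq_or_lt with hS' | hS'
    · obtain ⟨r, hr⟩ := hθ.flat_nonempty hp hS
      rw [hS', Nat.sub_self, hQ0, Finset.card_eq_one]
      have hdist : ∀ a b : Fin n, a < b → (b : ℕ) < m + 1 → power θ a r ≠ power θ b r := by
        intro a b hab hb h
        have hbS : b ∉ S := fun hbS => by have := hSm b hbS; omega
        have hemp := hθ.flat_eq_empty (insert b S) (Function.update p b a)
          (forest S p b a hp hbS hab) (by rw [Finset.card_insert_of_notMem hbS, hS'])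
        rw [bisectorFlat_insert θ hbS] at hemp
        exact Set.notMem_empty r (hemp ▸ ⟨hr, h⟩)
      refine ⟨orderPattern (power θ) (m + 1) r, Finset.eq_singleton_iff_unique_mem.2
        ⟨mem_orderPatterns.2 ⟨r, hr, fun a b ha hb hab => ?_, rfl⟩, ?_⟩⟩
      · rcases lt_trichotomy a b with h | h | h
        · exact absurd hab (hdist a b h hb)
        · exact h
        · exact absurd hab.symm (hdist b a h ha)
      · intro T hT
        obtain ⟨s, hs, -, rfl⟩ := mem_orderPatterns.1 hT
        rw [hθ.flat_subsingleton hp hS' hs hr]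
    · have hq : (⟨m, hmn⟩ : Fin n) ∉ S := fun h => by have := hSm _ h; simp at this
      have hcross : CrossesTies (power θ) ⟨m, hmn⟩ (bisectorFlat θ S p) := by
        refine crossesTies_bisectorFlat θ S p _ fun i hi => ?_
        obtain ⟨w, hw⟩ := (hθ.linearIndepOn _ _ (forest S p _ i hp hq hi)
          (by rw [Finset.card_insert_of_notMem hq]; exact hS')).exists_inner_eq
          (fun v => if v = ⟨m, hmn⟩ then 1 else 0)
        refine ⟨w, fun v hv => ?_, ?_⟩
        · have hne : v ≠ ⟨m, hmn⟩ := by rintro rfl; exact hq hv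
          simpa [hne] using hw v (by simp [hv])
        · simpa using hw ⟨m, hmn⟩ (by simp)
      rw [card_orderPatterns_succ hmn hcross, ih (by omega) S p hp (fun v hv =>
        (Nat.le_succ m).trans (hSm v hv)) hS, hQrec (m + 1) _ (by omega) (by omega)]
      congr 1
      rw [Finset.sum_congr rfl (g := fun _ => Q (m, Module.finrank ℝ E - S.card - 1))]
      · rw [Finset.sum_const, smul_eq_mul]
        congr 1
        have : (Finset.univ.filter fun i : Fin n => (i : ℕ) < m) =
            Finset.Iio (⟨m, hmn⟩ : Fin n) := by
          ext i; simp [Fin.lt_def]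
        rw [this, Fin.card_Iio]
        rfl
      · intro i hi
        rw [← bisectorFlat_insert θ hq, ih (by omega) _ _
          (forest S p _ i hp hq (Finset.mem_filter.1 hi).2), Finset.card_insert_of_notMem hq,
          Nat.sub_sub]
        · intro v hv
          rcases Finset.mem_insert.1 hv with rfl | hv
          · exact le_rfl
          · exact (Nat.le_succ m).trans (hSm v hv)
        · rw [Finset.card_insert_of_notMem hq]; exact hS'

end Geometry

section AlmostEverywhere

theorem MeasureTheory.volume_eq_zero_of_update {ι : Type*} [Fintype ι] [DecidableEq ι]
    {X : ι → Type*} [∀ i, MeasureSpace (X i)] [∀ i, SigmaFinite (volume : Measure (X i))]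
    {A : Set (∀ i, X i)} (hA : MeasurableSet A) (i : ι)
    (h : ∀ θ, volume {x | Function.update θ i x ∈ A} = 0) : volume A = 0 := by
  rw [← lintegral_indicator_one hA, volume_pi,
    lintegral_eq_of_lmarginal_eq (g := 0) {i} (measurable_one.indicator hA) measurable_zero]
  · simp
  · rw [lmarginal_singleton, lmarginal_singleton]
    ext θ
    have hm : MeasurableSet {x | Function.update θ i x ∈ A} :=
      (measurable_update θ) hA
    have := lintegral_indicator_one (μ := volume) hm
    rw [h θ] at this
    simp only [Pi.zero_apply, lintegral_zero]
    exact this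

theorem measurableSet_linearIndepOn {V Y ι : Type*} [NormedAddCommGroup V] [NormedSpace ℝ V]
    [FiniteDimensional ℝ V] [TopologicalSpace Y] [MeasurableSpace Y] [OpensMeasurableSpace Y]
    (u : Y → ι → V) (hu : ∀ v, Continuous fun y => u y v) (S : Finset ι) :
    MeasurableSet {y | LinearIndepOn ℝ (u y) (S : Set ι)} := by
  have hopen := (isOpen_setOfPred_linearIndependent (𝕜 := ℝ) (E := V) (ι := (S : Set ι)))
  have hc : Continuous fun y => fun v : (S : Set ι) => u y v := by fun_prop
  exact (hopen.preimage hc).measurableSet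

variable {n d : ℕ}

theorem linearIndepOn_sub_update_iff {E : Type*} [AddCommGroup E] [Module ℝ E] (θ : Fin n → E)
    (p : Fin n → Fin n) {S : Finset (Fin n)} {a : Fin n} (ha : ∀ v ∈ S, v < a)
    (hp : ∀ v ∈ S, p v < v) (x : E) :
    LinearIndepOn ℝ (fun v => Function.update θ a x v - Function.update θ a x (p v))
      (S : Set (Fin n)) ↔ LinearIndepOn ℝ (fun v => θ v - θ (p v)) (S : Set (Fin n)) := by
  have hd : Set.EqOn (fun v => Function.update θ a x v - Function.update θ a x (p v))
      (fun v => θ v - θ (p v)) (S : Set (Fin n)) := fun v hv => by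
    simp only
    rw [Function.update_of_ne (ha v hv).ne, Function.update_of_ne ((hp v hv).trans (ha v hv)).ne]
  exact linearIndepOn_congr hd

theorem LinearIndepOn.insert_sub_update {E : Type*} [AddCommGroup E] [Module ℝ E]
    {θ : Fin n → E} {p : Fin n → Fin n} {S : Finset (Fin n)} {a : Fin n}
    (h : LinearIndepOn ℝ (fun v => θ v - θ (p v)) (S : Set (Fin n))) (ha : ∀ v ∈ S, v < a)
    (hp : ∀ v ∈ S, p v < v) (hpa : p a < a) {x : E}
    (hx : x - θ (p a) ∉ Submodule.span ℝ ((fun v => θ v - θ (p v)) '' (S : Set (Fin n)))) :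
    LinearIndepOn ℝ (fun v => Function.update θ a x v - Function.update θ a x (p v))
      ((insert a S : Finset (Fin n)) : Set (Fin n)) := by
  have hd : Set.EqOn (fun v => Function.update θ a x v - Function.update θ a x (p v))
      (fun v => θ v - θ (p v)) (S : Set (Fin n)) := fun v hv => by
    simp only
    rw [Function.update_of_ne (ha v hv).ne, Function.update_of_ne ((hp v hv).trans (ha v hv)).ne]
  rw [Finset.coe_insert]
  refine ((linearIndepOn_sub_update_iff θ p ha hp x).2 h).insert ?_
  rwa [Set.image_congr hd, Function.update_self, Function.update_of_ne hpa.ne]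

theorem ae_linearIndepOn_sub (p : Fin n → Fin n) (S : Finset (Fin n)) (hp : ∀ v ∈ S, p v < v)
    (hS : S.card ≤ d) : ∀ᵐ θ : Fin n → EuclideanSpace ℝ (Fin d),
      LinearIndepOn ℝ (fun v => θ v - θ (p v)) (S : Set (Fin n)) := by
  induction S using Finset.induction_on_max with
  | empty => simp
  | insert a S ha ih =>
    have haS : a ∉ S := fun h => (ha a h).false
    rw [Finset.card_insert_of_notMem haS] at hS
    have hpS : ∀ v ∈ S, p v < v := fun v hv => hp v (Finset.mem_insert_of_mem hv)
    have hpa : p a < a := hp a (Finset.mem_insert_self _ _)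
    have hmeas (T : Finset (Fin n)) := measurableSet_linearIndepOn
      (fun (θ : Fin n → EuclideanSpace ℝ (Fin d)) v => θ v - θ (p v)) (fun v => by fun_prop) T
    have hnull := volume_eq_zero_of_update ((hmeas S).diff (hmeas (insert a S))) a fun θ => by
      by_cases hli : LinearIndepOn ℝ (fun v => θ v - θ (p v)) (S : Set (Fin n))
      · let W := Submodule.span ℝ ((fun v => θ v - θ (p v)) '' (S : Set (Fin n)))
        have hW : W ≠ ⊤ := by
          intro h
          have h1 := finrank_span_finset_le_card (R := ℝ) (S.image fun v => θ v - θ (p v))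
          rw [Finset.coe_image] at h1
          change Module.finrank ℝ W ≤ _ at h1
          rw [h, finrank_top, finrank_euclideanSpace_fin] at h1
          have := Finset.card_image_le (s := S) (f := fun v => θ v - θ (p v))
          omega
        refine measure_mono_null (t := (fun x => x - θ (p a)) ⁻¹' (W : Set _)) ?_ ?_
        · rintro x ⟨-, hx⟩
          by_contra hxW
          exact hx (hli.insert_sub_update ha hpS hpa hxW)
        · simp only [sub_eq_add_neg, measure_preimage_add_right]
          exact Measure.addHaar_submodule _ _ hW
      · convert measure_empty (μ := volume)
        refine Set.eq_empty_of_forall_notMem fun x hx =>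
          hli ((linearIndepOn_sub_update_iff θ p ha hpS x).1 hx.1)
    have hnull' := compl_mem_ae_iff.2 hnull
    filter_upwards [ih hpS (by omega), hnull'] with θ h1 h2
    by_contra h3
    exact h2 ⟨h1, h3⟩

/-- The difference of the lifts of `θ v` and `θ (p v)` to the paraboloid `t = ‖x‖ ^ 2`. -/
def liftedDifference {n : ℕ} {E : Type*} [NormedAddCommGroup E] (θ : Fin n → E)
    (p : Fin n → Fin n) (v : Fin n) : E × ℝ :=
  (θ v - θ (p v), ‖θ v‖ ^ 2 - ‖θ (p v)‖ ^ 2)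

theorem liftedDifference_mem_ker {E : Type*} [NormedAddCommGroup E] [InnerProductSpace ℝ E]
    (θ : Fin n → E) (p : Fin n → Fin n) (v : Fin n) (r : E) :
    liftedDifference θ p v ∈ LinearMap.ker
      (LinearMap.snd ℝ E ℝ - (2 : ℝ) • (innerₗ E r).comp (LinearMap.fst ℝ E ℝ)) ↔
    power θ v r = power θ (p v) r := by
  rw [LinearMap.mem_ker, power, power]
  simp only [liftedDifference, LinearMap.sub_apply, LinearMap.snd_apply, LinearMap.smul_apply,
    LinearMap.comp_apply, LinearMap.fst_apply, innerₗ_apply_apply, smul_eq_mul, inner_sub_right,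
    real_inner_comm r]
  constructor <;> intro h <;> linarith

theorem bisectorFlat_eq_empty {θ : Fin n → EuclideanSpace ℝ (Fin d)} {p : Fin n → Fin n}
    {S : Finset (Fin n)} (hS : S.card = d + 1)
    (h : LinearIndepOn ℝ (liftedDifference θ p) (S : Set (Fin n))) :
    bisectorFlat θ S p = ∅ := by
  refine Set.eq_empty_of_forall_notMem fun r hr => ?_
  have hspan := h.linearIndependent.span_eq_top_of_card_eq_finrank' (by simp [hS])
  have hle : Submodule.span ℝ (Set.range fun v : (S : Set (Fin n)) => liftedDifference θ p v) ≤
      LinearMap.ker (LinearMap.snd ℝ _ ℝ - (2 : ℝ) •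
        (innerₗ (EuclideanSpace ℝ (Fin d)) r).comp (LinearMap.fst ℝ _ ℝ)) := by
    rw [Submodule.span_le]
    rintro _ ⟨v, rfl⟩
    exact (liftedDifference_mem_ker θ p v r).2 (hr v v.2)
  rw [hspan] at hle
  have := LinearMap.mem_ker.1 (hle (x := (0, 1)) trivial)
  simp at this

theorem LinearIndepOn.insert_liftedDifference_update {θ : Fin n → EuclideanSpace ℝ (Fin d)}
    {p : Fin n → Fin n} {T : Finset (Fin n)} {a : Fin n}
    (h : LinearIndepOn ℝ (fun v => θ v - θ (p v)) (T : Set (Fin n))) (ha : ∀ v ∈ T, v < a)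
    (hp : ∀ v ∈ T, p v < v) (hpa : p a < a) {r x : EuclideanSpace ℝ (Fin d)}
    (hr : ∀ v ∈ T, power θ v r = power θ (p v) r) (hx : dist x r ≠ dist (θ (p a)) r) :
    LinearIndepOn ℝ (liftedDifference (Function.update θ a x) p)
      ((insert a T : Finset (Fin n)) : Set (Fin n)) := by
  have hfst : LinearIndepOn ℝ
      (LinearMap.fst ℝ _ ℝ ∘ liftedDifference (Function.update θ a x) p) (T : Set (Fin n)) :=
    (linearIndepOn_sub_update_iff θ p ha hp x).2 h
  rw [Finset.coe_insert]
  refine (LinearIndepOn.of_comp _ hfst).insert fun hmem => ?_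
  have hle : Submodule.span ℝ
      (liftedDifference (Function.update θ a x) p '' (T : Set (Fin n))) ≤
      LinearMap.ker (LinearMap.snd ℝ _ ℝ - (2 : ℝ) •
        (innerₗ (EuclideanSpace ℝ (Fin d)) r).comp (LinearMap.fst ℝ _ ℝ)) := by
    rw [Submodule.span_le]
    rintro _ ⟨v, hv, rfl⟩
    refine (liftedDifference_mem_ker _ _ _ r).2 ?_
    rw [power, power, Function.update_of_ne (ha v hv).ne,
      Function.update_of_ne ((hp v hv).trans (ha v hv)).ne]
    exact hr v hv
  have h1 := (liftedDifference_mem_ker _ _ _ r).1 (hle hmem)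
  rw [power_eq, power_eq, sub_left_inj, Function.update_self,
    Function.update_of_ne hpa.ne] at h1
  exact hx ((sq_eq_sq₀ dist_nonneg dist_nonneg).1 h1)

theorem ae_bisectorFlat_eq_empty (hd : 1 ≤ d) (p : Fin n → Fin n) (S : Finset (Fin n))
    (hp : ∀ v ∈ S, p v < v) (hS : S.card = d + 1) :
    ∀ᵐ θ : Fin n → EuclideanSpace ℝ (Fin d), bisectorFlat θ S p = ∅ := by
  have : Nontrivial (EuclideanSpace ℝ (Fin d)) :=
    Module.nontrivial_of_finrank_pos (R := ℝ) (by rw [finrank_euclideanSpace_fin]; exact hd)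
  obtain ⟨a, haS, hmax⟩ := S.exists_max_image id (Finset.card_pos.1 (by omega))
  set T := S.erase a with hT
  have hTS : insert a T = S := Finset.insert_erase haS
  have ha : ∀ v ∈ T, v < a := fun v hv =>
    lt_of_le_of_ne (hmax v (Finset.mem_of_mem_erase hv)) (Finset.ne_of_mem_erase hv)
  have hpT : ∀ v ∈ T, p v < v := fun v hv => hp v (Finset.mem_of_mem_erase hv)
  have hpa : p a < a := hp a haS
  have hTcard : T.card = d := by rw [Finset.card_erase_of_mem haS, hS, Nat.add_sub_cancel]
  have hm1 := measurableSet_linearIndepOn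
    (fun (θ : Fin n → EuclideanSpace ℝ (Fin d)) v => θ v - θ (p v)) (fun v => by fun_prop) T
  have hm2 := measurableSet_linearIndepOn
    (fun (θ : Fin n → EuclideanSpace ℝ (Fin d)) v => liftedDifference θ p v)
    (fun v => by unfold liftedDifference; fun_prop) S
  have hnull := volume_eq_zero_of_update (hm1.diff hm2) a fun θ => by
    by_cases hli : LinearIndepOn ℝ (fun v => θ v - θ (p v)) (T : Set (Fin n))
    · obtain ⟨r, hr⟩ := hli.exists_inner_eq fun v => (‖θ v‖ ^ 2 - ‖θ (p v)‖ ^ 2) / 2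
      refine measure_mono_null (t := Metric.sphere r (dist (θ (p a)) r)) ?_
        (Measure.addHaar_sphere _ _ _)
      rintro x ⟨-, hx⟩
      by_contra hxs
      apply hx
      have := hli.insert_liftedDifference_update ha hpT hpa
        (fun v hv => (power_eq_iff_inner ..).2 (hr v hv)) hxs
      rwa [hTS] at this
    · convert measure_empty (μ := volume)
      refine Set.eq_empty_of_forall_notMem fun x hx =>
        hli ((linearIndepOn_sub_update_iff θ p ha hpT x).1 hx.1)
  filter_upwards [ae_linearIndepOn_sub p T hpT hTcard.le, compl_mem_ae_iff.2 hnull] with θ h1 h2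
  refine bisectorFlat_eq_empty hS ?_
  by_contra h3
  exact h2 ⟨h1, h3⟩

theorem ae_genericConfiguration (hd : 1 ≤ d) :
    ∀ᵐ θ : Fin n → EuclideanSpace ℝ (Fin d), GenericConfiguration d θ := by
  have h1 : ∀ᵐ θ : Fin n → EuclideanSpace ℝ (Fin d), ∀ (S : Finset (Fin n)) (p : Fin n → Fin n),
      (∀ v ∈ S, p v < v) → S.card ≤ d →
        LinearIndepOn ℝ (fun v => θ v - θ (p v)) (S : Set (Fin n)) := by
    simp only [ae_all_iff]
    exact fun S p hp hS => ae_linearIndepOn_sub p S hp hS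
  have h2 : ∀ᵐ θ : Fin n → EuclideanSpace ℝ (Fin d), ∀ (S : Finset (Fin n)) (p : Fin n → Fin n),
      (∀ v ∈ S, p v < v) → S.card = d + 1 → bisectorFlat θ S p = ∅ := by
    simp only [ae_all_iff]
    exact fun S p hp hS => ae_bisectorFlat_eq_empty hd p S hp hS
  filter_upwards [h1, h2] with θ h1 h2 using ⟨h1, h2⟩

end AlmostEverywhere

theorem ncard_realizableRankings {n d : ℕ} (θ : Fin n → EuclideanSpace ℝ (Fin d)) :
    (realizableRankings θ).ncard = (orderPatterns (power θ) n Set.univ).card := by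
  classical
  rw [← Set.ncard_coe_finset]
  refine Set.ncard_congr (fun σ _ => Finset.univ.filter fun a : Fin n × Fin n =>
    σ.symm a.1 < σ.symm a.2) ?_ ?_ ?_
  · rintro σ ⟨r, hr⟩
    refine mem_orderPatterns.2 ⟨r, trivial, fun a b _ _ hab => ?_, ?_⟩
    · have h1 := hr a b
      have h2 := hr b a
      rw [← power_lt_iff] at h1 h2
      apply σ.symm.injective
      apply le_antisymm
      · exact not_lt.1 fun h => (h2.1 h).ne' hab
      · exact not_lt.1 fun h => (h1.1 h).ne hab
    · ext a
      simp [orderPattern, hr, power_lt_iff]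
  · rintro σ τ hσ hτ h
    have h1 : ∀ i j, σ.symm i < σ.symm j ↔ τ.symm i < τ.symm j := fun i j => by
      simpa using Finset.ext_iff.1 h (i, j)
    have hmono : StrictMono (σ.trans τ.symm) := fun i j hij => by
      simpa using (h1 (σ i) (σ j)).1 (by simpa using hij)
    have hid : hmono.orderIsoOfSurjective _ (σ.trans τ.symm).surjective = OrderIso.refl _ :=
      Subsingleton.elim _ _
    ext i
    have : τ.symm (σ i) = i := DFunLike.congr_fun hid i
    rw [Equiv.symm_apply_eq] at this
    rw [this]
  · intro T hT
    obtain ⟨r, -, hr, rfl⟩ := mem_orderPatterns.1 (Finset.mem_coe.1 hT)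
    let g : Fin n → ℝ := fun i => power θ i r
    have hg : Function.Injective g := fun a b hab => hr a b a.2 b.2 hab
    have hmono : StrictMono (g ∘ Tuple.sort g) :=
      (Tuple.monotone_sort g).strictMono_of_injective (hg.comp (Tuple.sort g).injective)
    have hlt : ∀ i j, (Tuple.sort g).symm i < (Tuple.sort g).symm j ↔ g i < g j := fun i j => by
      rw [← hmono.lt_iff_lt]
      simp
    refine ⟨Tuple.sort g, ⟨r, fun i j => (hlt i j).trans (power_lt_iff θ i j r)⟩, ?_⟩
    ext a
    simp [orderPattern, hlt, g]

/-- if `Q` satisfies the recursion, then for Lebesgue-almost every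
configuration of `n` points in `ℝ^d` the number of realizable rankings is `Q(n,d)`. -/
theorem stmt_0 (Q : ℕ × ℕ → ℕ)
    (hQ1 : ∀ d : ℕ, Q (1, d) = 1)
    (hQ0 : ∀ n : ℕ, Q (n, 0) = 1)
    (hQrec : ∀ n d : ℕ, 2 ≤ n → 1 ≤ d → Q (n, d) = Q (n - 1, d) + (n - 1) * Q (n - 1, d - 1))
    (n d : ℕ) (hn : 1 ≤ n) (hd : 1 ≤ d) :
    ∀ᵐ θ : Fin n → EuclideanSpace ℝ (Fin d) ∂volume,
      (realizableRankings θ).ncard = Q (n, d) := by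
  filter_upwards [ae_genericConfiguration (n := n) hd] with θ hθ
  have hfin : Module.finrank ℝ (EuclideanSpace ℝ (Fin d)) = d := finrank_euclideanSpace_fin
  have hθ' : GenericConfiguration (Module.finrank ℝ (EuclideanSpace ℝ (Fin d))) θ := by
    rwa [hfin]
  have h := card_orderPatterns_bisectorFlat hθ' Q hQ1 hQ0 hQrec hn le_rfl ∅ id (by simp) (by simp)
    (by simp)
  have huniv : bisectorFlat θ ∅ id = Set.univ := by simp [bisectorFlat]
  rw [ncard_realizableRankings, ← huniv, h]
  simp
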